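/- For the generalized q-exponential polynomial Φ_n[x,r,m]_q = Σ_{k=0}^n W_{m,r}[n,k]_q x^k, one has the operator recurrence Φ_n[x,r,m]_q = (q^r x + (q^m - 1) q^r x^2 D_{q^m} + [r]_q + q^r [m]_q x D_{q^m}) Φ_{n-1}[x,r,m]_q, where D_{q^m} is the q^m-derivative operator (D_p f)(x) = (f(x) - f(px))/((1-p)x). -/

import Mathlib

/-- The q-integer `[t]_q = 1 + q + ... + q^(t-1)`. -/
def qint {K : Type*} [CommRing K] (q : K) (t : ℕ) : K :=
  ∑ i ∈ Finset.range t, q ^ i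

/-- The q-analogue of the r-Whitney numbers of the second kind, defined by
`W[0,0] = 1`, vanishing outside `0 ≤ k ≤ n`, and the triangular recurrence. -/
def W {K : Type*} [CommRing K] (q : K) (m r : ℕ) : ℕ → ℕ → K
  | 0, 0 => 1
  | 0, _ + 1 => 0
  | n + 1, 0 => qint q r * W q m r n 0
  | n + 1, k + 1 => q ^ (m * k + r) * W q m r n k + qint q (m * (k + 1) + r) * W q m r n (k + 1)

open Polynomial in
/-- The p-derivative operator on polynomials, sending `x^k` to `[k]_p x^(k-1)`. -/
noncomputable def qderiv {K : Type*} [CommRing K] (p : K) (f : Polynomial K) : Polynomial K :=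
  f.sum fun n a => Polynomial.C (a * qint p n) * Polynomial.X ^ (n - 1)

open Polynomial in
/-- The generalized q-exponential polynomial `Φ_n[x,r,m]_q = Σ_{k=0}^n W_{m,r}[n,k]_q x^k`. -/
noncomputable def Phi {K : Type*} [Field K] (q : K) (m r : ℕ) (n : ℕ) : Polynomial K :=
  ∑ k ∈ Finset.range (n + 1), Polynomial.C (W q m r n k) * Polynomial.X ^ k

theorem aux_W_zero {K : Type*} [CommRing K] (q : K) (m r : ℕ) :
    ∀ n k : ℕ, n < k → W q m r n k = 0 := by
  intro n
  induction n with
  | zero =>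
    intro k hk
    cases k with
    | zero => omega
    | succ k => simp [W]
  | succ n ih =>
    intro k hk
    cases k with
    | zero => omega
    | succ k =>
      rw [W, ih k (by omega), ih (k + 1) (by omega)]
      simp

theorem aux_coeff_Phi {K : Type*} [Field K] (q : K) (m r n k : ℕ) :
    (Phi q m r n).coeff k = W q m r n k := by
  unfold Phi
  rw [Polynomial.finsetSum_coeff]
  simp only [Polynomial.coeff_C_mul_X_pow]
  rw [Finset.sum_ite_eq]
  split_ifs with h
  · rfl
  · rw [aux_W_zero]
    simpa using h

theorem aux_X_qderiv {K : Type*} [CommRing K] (p : K) (f : Polynomial K) (k : ℕ) :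
    (Polynomial.X * qderiv p f).coeff k = f.coeff k * qint p k := by
  have h : Polynomial.X * qderiv p f
      = ∑ n ∈ f.support, Polynomial.C (f.coeff n * qint p n) * Polynomial.X ^ n := by
    unfold qderiv
    rw [Polynomial.sum_def, Finset.mul_sum]
    refine Finset.sum_congr rfl fun n _ => ?_
    cases n with
    | zero => simp [qint]
    | succ n => rw [Nat.add_sub_cancel, pow_succ]; ring
  rw [h, Polynomial.finsetSum_coeff]
  simp only [Polynomial.coeff_C_mul_X_pow]
  rw [Finset.sum_ite_eq]
  split_ifs with h
  · rfl
  · rw [Polynomial.notMem_support_iff.mp h, zero_mul]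

theorem aux_qint_add {K : Type*} [CommRing K] (q : K) (a b : ℕ) :
    qint q (a + b) = qint q a + q ^ a * qint q b := by
  unfold qint
  rw [Finset.sum_range_add, Finset.mul_sum]
  simp only [pow_add]

theorem aux_qint_mul {K : Type*} [CommRing K] (q : K) (m k : ℕ) :
    qint q (m * k) = qint q m * qint (q ^ m) k := by
  induction k with
  | zero => simp [qint]
  | succ k ih =>
    rw [Nat.mul_succ, aux_qint_add, ih, aux_qint_add (q ^ m) k 1, pow_mul]
    simp [qint]
    ring

theorem aux_qint_geom {K : Type*} [CommRing K] (q : K) (k : ℕ) :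
    (q - 1) * qint q k = q ^ k - 1 := by
  unfold qint
  exact mul_geom_sum q k

open Polynomial in
/-- the operator recurrence
`Φ_n = (q^r x + (q^m - 1) q^r x^2 D_{q^m} + [r]_q + q^r [m]_q x D_{q^m}) Φ_{n-1}`. -/
theorem Phi_recurrence {K : Type*} [Field K] (q : K) (m r n : ℕ)
    (hm : 1 ≤ m) (hqm : q ^ m ≠ 1) (hn : 1 ≤ n) :
    Phi q m r n =
      Polynomial.C (q ^ r) * Polynomial.X * Phi q m r (n - 1)
        + Polynomial.C ((q ^ m - 1) * q ^ r) * Polynomial.X ^ 2 * qderiv (q ^ m) (Phi q m r (n - 1))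
        + Polynomial.C (qint q r) * Phi q m r (n - 1)
        + Polynomial.C (q ^ r * qint q m) * Polynomial.X * qderiv (q ^ m) (Phi q m r (n - 1)) := by
  obtain ⟨n, rfl⟩ : ∃ j, n = j + 1 := ⟨n - 1, by omega⟩
  rw [Nat.add_sub_cancel]
  set P := Phi q m r n with hP
  have e : Polynomial.C (q ^ r) * Polynomial.X * P
        + Polynomial.C ((q ^ m - 1) * q ^ r) * Polynomial.X ^ 2 * qderiv (q ^ m) P
        + Polynomial.C (qint q r) * P
        + Polynomial.C (q ^ r * qint q m) * Polynomial.X * qderiv (q ^ m) P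
      = Polynomial.C (q ^ r) * (Polynomial.X * P)
        + Polynomial.C ((q ^ m - 1) * q ^ r) * (Polynomial.X * (Polynomial.X * qderiv (q ^ m) P))
        + Polynomial.C (qint q r) * P
        + Polynomial.C (q ^ r * qint q m) * (Polynomial.X * qderiv (q ^ m) P) := by ring
  rw [e]
  ext k
  simp only [Polynomial.coeff_add, Polynomial.coeff_C_mul, aux_X_qderiv]
  cases k with
  | zero =>
    simp only [Polynomial.coeff_X_mul_zero, hP, aux_coeff_Phi, W]
    simp [qint]
  | succ k =>
    simp only [Polynomial.coeff_X_mul, aux_X_qderiv, hP, aux_coeff_Phi, W]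
    rw [add_comm (m * (k + 1)) r, aux_qint_add, aux_qint_mul, pow_add, pow_mul]
    linear_combination (-(q ^ r * W q m r n k)) * aux_qint_geom (q ^ m) k
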